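/- Let −𝒜 generate a strongly continuous contraction semigroup on a Hilbert space 𝓗̇, suppose σ(𝒜) ∩ iℝ = ∅ and 𝒜 is invertible, and suppose ‖(𝒜 − iλ)^{-1}‖ = O(λ²) as λ → ±∞. Then ‖e^{−t𝒜}𝒜^{-1}‖ = O(t^{-1/2}) as t → ∞, and for every x ∈ dom(𝒜), ‖e^{−t𝒜}x‖ = o(t^{-1/2}) as t → ∞. -/

import Mathlib

open Complex Filter

open MeasureTheory FourierTransform in
/-- Plancherel for `C²` compactly supported Hilbert-valued functions. -/
theorem bt_plancherel {H : Type*} [NormedAddCommGroup H] [InnerProductSpace ℂ H] [CompleteSpace H]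
    (f f' f'' : ℝ → H) (hf : ∀ t, HasDerivAt f (f' t) t) (hf' : ∀ t, HasDerivAt f' (f'' t) t)
    (hi : Integrable f) (hi' : Integrable f') (hi'' : Integrable f'') :
    Integrable (fun x => ‖𝓕 f x‖ ^ 2) ∧ ∫ x, ‖𝓕 f x‖ ^ 2 = ∫ x, ‖f x‖ ^ 2 := by
  have hcont : Continuous f := continuous_iff_continuousAt.2 fun t => (hf t).continuousAt
  have d1 : deriv f = f' := funext fun t => (hf t).deriv
  have d2 : deriv f' = f'' := funext fun t => (hf' t).deriv
  have e1 := Real.fourier_deriv hi (fun t => (hf t).differentiableAt) (by rwa [d1])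
  have e2 := Real.fourier_deriv hi' (fun t => (hf' t).differentiableAt) (by rwa [d2])
  rw [d1] at e1
  rw [d2, e1] at e2
  have bd : ∀ (g : ℝ → H) x, ‖𝓕 g x‖ ≤ ∫ t, ‖g t‖ := fun g x =>
    VectorFourier.norm_fourierIntegral_le_integral_norm Real.fourierChar volume (innerₗ ℝ) g x
  have hFc : Continuous (𝓕 f) :=
    VectorFourier.fourierIntegral_continuous Real.continuous_fourierChar
      (L := innerₗ ℝ) continuous_inner hi
  set K : ℝ := (∫ t, ‖f t‖) + ∫ t, ‖f'' t‖ with hK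
  have hbd : ∀ x, ‖𝓕 f x‖ ≤ K * (1 + x ^ 2)⁻¹ := by
    intro x
    have h0 := bd f x
    have h2 := bd f'' x
    rw [e2] at h2
    simp only [smul_smul, norm_smul, norm_mul, norm_ofNat, Complex.norm_real, Complex.norm_I, Real.norm_eq_abs, abs_of_pos Real.pi_pos, mul_one] at h2
    have h3 : x ^ 2 * ‖𝓕 f x‖ ≤ 2 * Real.pi * |x| * (2 * Real.pi * |x|) * ‖𝓕 f x‖ := by
      apply mul_le_mul_of_nonneg_right _ (norm_nonneg _)
      have : 1 ≤ (2 * Real.pi) * (2 * Real.pi) := by nlinarith [Real.pi_gt_three]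
      nlinarith [sq_abs x, sq_nonneg x]
    rw [← div_eq_mul_inv, le_div_iff₀ (by positivity)]
    nlinarith
  have hFi : Integrable (𝓕 f) :=
    (integrable_inv_one_add_sq.const_mul K).mono' hFc.aestronglyMeasurable
      (Eventually.of_forall hbd)
  have hK0 : 0 ≤ K := by positivity
  refine ⟨?_, ?_⟩
  · refine (hFi.norm.const_mul K).mono' (hFc.norm.pow 2).aestronglyMeasurable
      (Eventually.of_forall fun x => ?_)
    rw [Real.norm_eq_abs, abs_of_nonneg (by positivity), sq]
    apply mul_le_mul_of_nonneg_right _ (norm_nonneg _)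
    refine (hbd x).trans (mul_le_of_le_one_right hK0 (inv_le_one_of_one_le₀ (by nlinarith [sq_nonneg x])))
  · have key : ∫ ξ, (innerSL ℂ (𝓕 f ξ)) (𝓕 f ξ) = ∫ x, (innerSL ℂ (f x)) (𝓕⁻ (𝓕 f) x) := by
      have := VectorFourier.integral_sesq_fourierIntegral_eq_neg_flip (innerSL ℂ (E := H))
        (L := innerₗ ℝ) Real.continuous_fourierChar continuous_inner hi hFi
      rw [flip_innerₗ] at this
      exact this
    rw [hcont.fourierInv_fourier_eq hi hFi] at key
    apply Complex.ofRealLI.injective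
    simpa [← LinearIsometry.integral_comp_comm, inner_self_eq_norm_sq_to_K] using key

open MeasureTheory FourierTransform in
theorem bt_fourier_clm {H : Type*} [NormedAddCommGroup H] [InnerProductSpace ℂ H] [CompleteSpace H]
    (L : H →L[ℂ] H) (f : ℝ → H) (hi : Integrable f) (x : ℝ) :
    𝓕 (fun t => L (f t)) x = L (𝓕 f x) := by
  rw [Real.fourier_eq, Real.fourier_eq, ← L.integral_comp_comm]
  · simp [Circle.smul_def]
  · exact (VectorFourier.fourierIntegral_convergent_iff (L := innerₗ ℝ) Real.continuous_fourierChar continuous_inner x).2 hi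

open MeasureTheory FourierTransform in
theorem bt_fourier_sub {H : Type*} [NormedAddCommGroup H] [InnerProductSpace ℂ H] [CompleteSpace H]
    (f g : ℝ → H) (hi : Integrable f) (hg : Integrable g) (x : ℝ) :
    𝓕 (fun t => f t - g t) x = 𝓕 f x - 𝓕 g x := by
  rw [Real.fourier_eq, Real.fourier_eq, Real.fourier_eq, ← integral_sub]
  · simp [smul_sub]
  · exact (VectorFourier.fourierIntegral_convergent_iff (L := innerₗ ℝ) Real.continuous_fourierChar continuous_inner x).2 hi
  · exact (VectorFourier.fourierIntegral_convergent_iff (L := innerₗ ℝ) Real.continuous_fourierChar continuous_inner x).2 hg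

section semigroup

set_option linter.unusedSectionVars false

variable {H : Type*} [NormedAddCommGroup H] [InnerProductSpace ℂ H] [CompleteSpace H]

theorem bt_mvt (T : ℝ → H →L[ℂ] H) (B : H →L[ℂ] H) (hT0 : T 0 = 1)
    (hder : ∀ (y : H) (t : ℝ), 0 ≤ t →
      HasDerivWithinAt (fun s : ℝ => T s (B y)) (-(T t y)) (Set.Ici 0) t)
    (y z : H) (C s : ℝ) (hs : 0 ≤ s) (hb : ∀ r ∈ Set.Icc 0 s, ‖T r y - z‖ ≤ C) :
    ‖T s (B y) - B y + s • z‖ ≤ C * s := by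
  have h1 : ∀ r ∈ Set.Icc 0 s, HasDerivWithinAt (fun r : ℝ => T r (B y) + r • z)
      (-(T r y) + (1 : ℝ) • z) (Set.Icc 0 s) r := fun r hr =>
    ((hder y r hr.1).mono Set.Icc_subset_Ici_self).add
      ((hasDerivWithinAt_id r _).smul_const z)
  have h2 := (convex_Icc (0 : ℝ) s).norm_image_sub_le_of_norm_hasDerivWithin_le (C := C) h1
    (fun r hr => by
      have := hb r hr
      rw [← norm_neg] at this
      have e : -(T r y) + (1 : ℝ) • z = -(T r y - z) := by rw [one_smul]; abel
      rw [e]; exact this) (Set.left_mem_Icc.2 hs) (Set.right_mem_Icc.2 hs)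
  simp only [hT0, one_apply_eq_self, zero_smul, add_zero, sub_zero,
    Real.norm_eq_abs, abs_of_nonneg hs] at h2
  convert h2 using 2
  abel

theorem bt_inj (T : ℝ → H →L[ℂ] H) (B : H →L[ℂ] H) (hT0 : T 0 = 1)
    (hcontr : ∀ t : ℝ, 0 ≤ t → ‖T t‖ ≤ 1)
    (hder : ∀ (y : H) (t : ℝ), 0 ≤ t →
      HasDerivWithinAt (fun s : ℝ => T s (B y)) (-(T t y)) (Set.Ici 0) t)
    (w : H) (hw : ∀ s, 0 ≤ s → T s w = w) : w = 0 := by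
  have h1 : ∀ s : ℝ, 0 ≤ s → s * ‖w‖ ≤ 2 * ‖B w‖ := by
    intro s hs
    have := bt_mvt T B hT0 hder w w 0 s hs (fun r hr => by simp [hw r hr.1])
    rw [zero_mul, norm_le_zero_iff] at this
    have e : s • w = B w - T s (B w) := by
      rw [← sub_eq_zero, ← this]; abel
    have e2 : ‖s • w‖ = s * ‖w‖ := by rw [norm_smul, Real.norm_eq_abs, abs_of_nonneg hs]
    rw [← e2, e]
    have := (T s).le_of_opNorm_le (hcontr s hs) (B w)
    linarith [norm_sub_le (B w) (T s (B w))]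
  by_contra hne
  have hpos : 0 < ‖w‖ := norm_pos_iff.2 hne
  have := h1 ((2 * ‖B w‖ + 1) / ‖w‖) (by positivity)
  rw [div_mul_cancel₀ _ hpos.ne'] at this
  linarith

theorem bt_comm (T : ℝ → H →L[ℂ] H) (B : H →L[ℂ] H) (hT0 : T 0 = 1)
    (hTadd : ∀ s t : ℝ, 0 ≤ s → 0 ≤ t → T (s + t) = (T s).comp (T t))
    (hcontr : ∀ t : ℝ, 0 ≤ t → ‖T t‖ ≤ 1)
    (hder : ∀ (y : H) (t : ℝ), 0 ≤ t →
      HasDerivWithinAt (fun s : ℝ => T s (B y)) (-(T t y)) (Set.Ici 0) t)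
    (t : ℝ) (ht : 0 ≤ t) (y : H) : T t (B y) = B (T t y) := by
  have comm : ∀ s, 0 ≤ s → ∀ v, T s (T t v) = T t (T s v) := by
    intro s hs v
    have h1 := hTadd s t hs ht
    rw [add_comm, hTadd t s ht hs] at h1
    exact (congrArg (fun L : H →L[ℂ] H => L v) h1).symm
  rw [← sub_eq_zero]
  apply bt_inj T B hT0 hcontr hder
  intro s hs
  have h1 : ∀ r ∈ Set.Icc 0 s, HasDerivWithinAt
      (fun r : ℝ => T t (T r (B y)) - T r (B (T t y)))
      (T t (-(T r y)) - -(T r (T t y))) (Set.Icc 0 s) r := fun r hr =>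
    ((((T t).restrictScalars ℝ).hasFDerivAt.comp_hasDerivWithinAt r (hder y r hr.1)).sub
      (hder (T t y) r hr.1)).mono Set.Icc_subset_Ici_self
  have h2 := (convex_Icc (0 : ℝ) s).norm_image_sub_le_of_norm_hasDerivWithin_le (C := 0) h1
    (fun r hr => by simp [comm r hr.1]) (Set.left_mem_Icc.2 hs) (Set.right_mem_Icc.2 hs)
  rw [zero_mul, norm_le_zero_iff, sub_eq_zero] at h2
  simp only [hT0, one_apply_eq_self] at h2
  rw [map_sub, comm s hs, h2]

theorem bt_dense (T : ℝ → H →L[ℂ] H) (B : H →L[ℂ] H) (hT0 : T 0 = 1)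
    (hder : ∀ (y : H) (t : ℝ), 0 ≤ t →
      HasDerivWithinAt (fun s : ℝ => T s (B y)) (-(T t y)) (Set.Ici 0) t)
    (hcomm : ∀ t, 0 ≤ t → ∀ y, T t (B y) = B (T t y)) : DenseRange B := by
  have h : (LinearMap.range B.toLinearMap).topologicalClosure = ⊤ := by
    rw [Submodule.topologicalClosure_eq_top_iff, Submodule.eq_bot_iff]
    intro w hw
    have hw' : ∀ y, inner ℂ w (B y) = 0 := fun y =>
      (Submodule.mem_orthogonal' _ _).1 hw _ ⟨y, rfl⟩
    have h1 : HasDerivWithinAt (fun s : ℝ => inner ℂ w (T s (B w))) (inner ℂ w (-(T 0 w)))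
        (Set.Ici 0) 0 :=
      ((innerSL ℂ w).restrictScalars ℝ).hasFDerivAt.comp_hasDerivWithinAt 0 (hder w 0 le_rfl)
    have h2 : HasDerivWithinAt (fun s : ℝ => inner ℂ w (T s (B w))) 0 (Set.Ici 0) 0 :=
      (hasDerivWithinAt_const (0 : ℝ) (Set.Ici (0 : ℝ)) (0 : ℂ)).congr
        (fun s hs => by rw [hcomm s hs, hw']) (by rw [hcomm 0 le_rfl, hw'])
    have h3 := (uniqueDiffOn_Ici (0 : ℝ) 0 Set.self_mem_Ici).eq_deriv _ h1 h2
    simpa [hT0] using h3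
  have := (Submodule.dense_iff_topologicalClosure_eq_top).2 h
  exact this

theorem bt_W_cont (T : ℝ → H →L[ℂ] H)
    (hTcont : ∀ x : H, ContinuousOn (fun t : ℝ => T t x) (Set.Ici 0))
    (a b : ℝ) (ha : 0 < a) (φ : ℝ → ℝ) (hφ : ContDiff ℝ (⊤ : ℕ∞) φ)
    (h0 : ∀ t, t ∉ Set.Icc a b → φ t = 0) (x : H) : Continuous (fun t => φ t • T t x) := by
  rw [continuous_iff_continuousAt]
  intro t
  rcases lt_or_ge t a with h | h
  · have : (fun t => φ t • T t x) =ᶠ[nhds t] fun _ => 0 := by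
      filter_upwards [Iio_mem_nhds h] with s hs
      rw [h0 s (fun h' => absurd h'.1 (not_le.2 hs)), zero_smul]
    exact continuousAt_const.congr this.symm
  · exact hφ.continuous.continuousAt.smul
      ((hTcont x).continuousAt (Ici_mem_nhds (ha.trans_le h)))

theorem bt_W_deriv (T : ℝ → H →L[ℂ] H) (B : H →L[ℂ] H)
    (hder : ∀ (y : H) (t : ℝ), 0 ≤ t →
      HasDerivWithinAt (fun s : ℝ => T s (B y)) (-(T t y)) (Set.Ici 0) t)
    (a b : ℝ) (ha : 0 < a) (φ : ℝ → ℝ) (hφ : ContDiff ℝ (⊤ : ℕ∞) φ)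
    (h0 : ∀ t, t ∉ Set.Icc a b → φ t = 0) (h0' : ∀ t, t ∉ Set.Icc a b → deriv φ t = 0)
    (y : H) (t : ℝ) :
    HasDerivAt (fun t => φ t • T t (B y)) (deriv φ t • T t (B y) - φ t • T t y) t := by
  rcases lt_or_ge t a with h | h
  · have : (fun t => φ t • T t (B y)) =ᶠ[nhds t] fun _ => 0 := by
      filter_upwards [Iio_mem_nhds h] with s hs
      rw [h0 s (fun h' => absurd h'.1 (not_le.2 hs)), zero_smul]
    have ht : t ∉ Set.Icc a b := fun h' => absurd h'.1 (not_le.2 h)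
    rw [h0 t ht, h0' t ht, zero_smul, zero_smul, sub_zero]
    exact (hasDerivAt_const t (0 : H)).congr_of_eventuallyEq this
  · have h1 := (hder y t (ha.le.trans h)).hasDerivAt (Ici_mem_nhds (ha.trans_le h))
    have h2 : HasDerivAt φ (deriv φ t) t :=
      (hφ.differentiable (by simp) t).hasDerivAt
    have h3 : HasDerivAt (fun t => φ t • T t (B y)) _ t := h2.smul h1
    convert h3 using 1
    rw [smul_neg]; abel

theorem bt_deriv_good (a b : ℝ) (φ : ℝ → ℝ) (h0 : ∀ t, t ∉ Set.Icc a b → φ t = 0) :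
    ∀ t, t ∉ Set.Icc a b → deriv φ t = 0 := by
  intro t ht
  have : φ =ᶠ[nhds t] fun _ => 0 := by
    filter_upwards [isClosed_Icc.isOpen_compl.mem_nhds ht] with s hs
    exact h0 s hs
  rw [this.deriv_eq]; simp

open MeasureTheory FourierTransform in
theorem bt_multiplier (T : ℝ → H →L[ℂ] H) (B : H →L[ℂ] H)
    (hTcont : ∀ x : H, ContinuousOn (fun t : ℝ => T t x) (Set.Ici 0))
    (hder : ∀ (y : H) (t : ℝ), 0 ≤ t →
      HasDerivWithinAt (fun s : ℝ => T s (B y)) (-(T t y)) (Set.Ici 0) t)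
    (hcomm : ∀ t, 0 ≤ t → ∀ y, T t (B y) = B (T t y))
    (R : ℝ → H →L[ℂ] H)
    (hR : ∀ (lam : ℝ) (g : H), R lam (g - (I * (lam : ℂ)) • B g) = B g)
    (M : ℝ) (hM : ∀ lam y, ‖B (B (R lam y))‖ ≤ M * ‖y‖)
    (a b : ℝ) (ha : 0 < a) (φ : ℝ → ℝ) (hφ : ContDiff ℝ (⊤ : ℕ∞) φ)
    (h0 : ∀ t, t ∉ Set.Icc a b → φ t = 0) (z : H) :
    ∫ t, ‖φ t • T t (B (B (B (B z))))‖ ^ 2 ≤ M ^ 2 * ∫ t, ‖deriv φ t • T t (B (B z))‖ ^ 2 := by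
  have h0' := bt_deriv_good a b φ h0
  have h0'' := bt_deriv_good a b _ h0'
  have h0''' := bt_deriv_good a b _ h0''
  have hφ' : ContDiff ℝ (⊤ : ℕ∞) (deriv φ) := (contDiff_infty_iff_deriv.1 hφ).2
  have hφ'' : ContDiff ℝ (⊤ : ℕ∞) (deriv (deriv φ)) := (contDiff_infty_iff_deriv.1 hφ').2
  have hφ''' : ContDiff ℝ (⊤ : ℕ∞) (deriv (deriv (deriv φ))) := (contDiff_infty_iff_deriv.1 hφ'').2
  have hint : ∀ (ψ : ℝ → ℝ), ContDiff ℝ (⊤ : ℕ∞) ψ → (∀ t, t ∉ Set.Icc a b → ψ t = 0) →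
      ∀ x : H, Integrable (fun t => ψ t • T t x) := by
    intro ψ hψ hψ0 x
    refine (bt_W_cont T hTcont a b ha ψ hψ hψ0 x).integrable_of_hasCompactSupport
      (HasCompactSupport.intro isCompact_Icc (K := Set.Icc a b) fun t ht => ?_)
    rw [hψ0 t ht, zero_smul]
  -- Plancherel for both
  have planch : ∀ (ψ : ℝ → ℝ), ContDiff ℝ (⊤ : ℕ∞) ψ → (∀ t, t ∉ Set.Icc a b → ψ t = 0) →
      ∀ z : H, Integrable (fun x => ‖𝓕 (fun t => ψ t • T t (B (B z))) x‖ ^ 2) ∧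
        ∫ x, ‖𝓕 (fun t => ψ t • T t (B (B z))) x‖ ^ 2 = ∫ t, ‖ψ t • T t (B (B z))‖ ^ 2 := by
    intro ψ hψ hψ0 z
    have hψ0' := bt_deriv_good a b ψ hψ0
    have hψ0'' := bt_deriv_good a b _ hψ0'
    have hψ' : ContDiff ℝ (⊤ : ℕ∞) (deriv ψ) := (contDiff_infty_iff_deriv.1 hψ).2
    have hψ'' : ContDiff ℝ (⊤ : ℕ∞) (deriv (deriv ψ)) := (contDiff_infty_iff_deriv.1 hψ').2
    exact bt_plancherel _ _ _ (bt_W_deriv T B hder a b ha ψ hψ hψ0 hψ0' (B z))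
      (fun t => (bt_W_deriv T B hder a b ha _ hψ' hψ0' hψ0'' (B z) t).sub
        (bt_W_deriv T B hder a b ha _ hψ hψ0 hψ0' z t))
      (hint ψ hψ hψ0 _) ((hint _ hψ' hψ0' _).sub (hint _ hψ hψ0 _))
      (((hint _ hψ'' hψ0'' _).sub (hint _ hψ' hψ0' _)).sub
        ((hint _ hψ' hψ0' _).sub (hint _ hψ hψ0 _)))
  have hWB : ∀ (ψ : ℝ → ℝ), (∀ t, t ∉ Set.Icc a b → ψ t = 0) →
      ∀ x : H, (fun t => ψ t • T t (B x)) = fun t => B (ψ t • T t x) := by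
    intro ψ hψ0 x
    funext t
    by_cases ht : t ∈ Set.Icc a b
    · rw [hcomm t (ha.le.trans ht.1), B.map_smul_of_tower]
    · simp [hψ0 t ht]
  -- the transform of `φ T x` is `R` applied to that of `φ' T x`
  have hres : ∀ η : ℝ, 𝓕 (fun t => φ t • T t (B (B z))) η =
      R (-(2 * Real.pi * η)) (𝓕 (fun t => deriv φ t • T t (B (B z))) η) := by
    intro η
    have hd := bt_W_deriv T B hder a b ha φ hφ h0 h0' (B z)
    have hdd : deriv (fun t => φ t • T t (B (B z))) =
        fun t => deriv φ t • T t (B (B z)) - φ t • T t (B z) := funext fun t => (hd t).deriv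
    have e1 := Real.fourier_deriv (hint φ hφ h0 (B (B z))) (fun t => (hd t).differentiableAt)
      (by rw [hdd]; exact (hint _ hφ' h0' _).sub (hint _ hφ h0 _))
    have e2 := congrFun e1 η
    rw [hdd, bt_fourier_sub _ _ (hint _ hφ' h0' _) (hint _ hφ h0 _)] at e2
    have e3 : 𝓕 (fun t => φ t • T t (B (B z))) η = B (𝓕 (fun t => φ t • T t (B z)) η) := by
      rw [hWB φ h0 (B z), bt_fourier_clm B _ (hint _ hφ h0 _)]
    rw [e3] at e2 ⊢
    rw [← hR (-(2 * Real.pi * η))]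
    congr 1
    rw [sub_eq_iff_eq_add] at e2
    rw [e2, sub_eq_add_neg, add_comm, ← neg_smul]
    congr 2
    push_cast
    ring
  have hB2 : ∀ η : ℝ, 𝓕 (fun t => φ t • T t (B (B (B (B z))))) η =
      B (B (𝓕 (fun t => φ t • T t (B (B z))) η)) := by
    intro η
    rw [hWB φ h0, bt_fourier_clm B _ (hint _ hφ h0 _), hWB φ h0, bt_fourier_clm B _ (hint _ hφ h0 _)]
  rw [← (planch φ hφ h0 (B (B z))).2, ← (planch _ hφ' h0' z).2, ← integral_const_mul]
  refine integral_mono (planch φ hφ h0 (B (B z))).1 ((planch _ hφ' h0' z).1.const_mul _) ?_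
  intro η
  simp only
  rw [hB2, hres, ← mul_pow]
  exact pow_le_pow_left₀ (norm_nonneg _) (hM _ _) 2

open MeasureTheory in
theorem bt_decay2 (T : ℝ → H →L[ℂ] H) (B : H →L[ℂ] H)
    (hTadd : ∀ s t : ℝ, 0 ≤ s → 0 ≤ t → T (s + t) = (T s).comp (T t))
    (hcontr : ∀ t : ℝ, 0 ≤ t → ‖T t‖ ≤ 1)
    (hTcont : ∀ x : H, ContinuousOn (fun t : ℝ => T t x) (Set.Ici 0))
    (hder : ∀ (y : H) (t : ℝ), 0 ≤ t →
      HasDerivWithinAt (fun s : ℝ => T s (B y)) (-(T t y)) (Set.Ici 0) t)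
    (hcomm : ∀ t, 0 ≤ t → ∀ y, T t (B y) = B (T t y))
    (hdense : DenseRange B)
    (R : ℝ → H →L[ℂ] H)
    (hR : ∀ (lam : ℝ) (g : H), R lam (g - (I * (lam : ℂ)) • B g) = B g)
    (M : ℝ) (hM : ∀ lam y, ‖B (B (R lam y))‖ ≤ M * ‖y‖) :
    ∃ K : ℝ, 0 ≤ K ∧ ∀ τ : ℝ, 0 < τ → ∀ x : H, ‖T τ (B (B x))‖ ≤ K / τ * ‖x‖ := by
  let ψ : ContDiffBump (1 / 2 : ℝ) := ⟨1 / 8, 1 / 4, by norm_num, by norm_num⟩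
  have hψ : ContDiff ℝ (⊤ : ℕ∞) ψ := ψ.contDiff
  have hψ0 : ∀ t, t ∉ Set.Icc (1 / 4 : ℝ) (3 / 4) → ψ t = 0 := by
    intro t ht
    apply ψ.zero_of_le_dist
    change (1 / 4 : ℝ) ≤ dist t (1 / 2)
    by_contra hlt
    rw [not_le, Real.dist_eq, abs_lt] at hlt
    exact ht ⟨by linarith [hlt.1], by linarith [hlt.2]⟩
  have hψ' : ContDiff ℝ (⊤ : ℕ∞) (deriv ψ) := (contDiff_infty_iff_deriv.1 hψ).2
  set c0 : ℝ := ∫ t, ψ t ^ 2 with hc0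
  set c1 : ℝ := ∫ t, deriv ψ t ^ 2 with hc1
  have hc0pos : 0 < c0 := by
    have hcs : HasCompactSupport (fun t => ψ t ^ 2) :=
      HasCompactSupport.intro isCompact_Icc (K := Set.Icc (1 / 4 : ℝ) (3 / 4)) fun t ht => by
        simp [hψ0 t ht]
    refine (hψ.continuous.pow 2).integral_pos_of_hasCompactSupport_nonneg_nonzero hcs
      (fun t => sq_nonneg _) (x := 1 / 2) ?_
    have : ψ (1 / 2) = 1 := ψ.one_of_mem_closedBall (by simp [ψ.rIn_pos.le])
    simp only [this]; norm_num
  have hc1nn : 0 ≤ c1 := integral_nonneg fun t => sq_nonneg _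
  refine ⟨Real.sqrt (M ^ 2 * c1 / c0), Real.sqrt_nonneg _, ?_⟩
  intro τ hτ x
  -- first for the dense range
  have main : ∀ z, ‖T τ (B (B (B (B z))))‖ ≤ Real.sqrt (M ^ 2 * c1 / c0) / τ * ‖B (B z)‖ := by
    intro z
    have hφ : ContDiff ℝ (⊤ : ℕ∞) (fun t : ℝ => ψ (t / τ)) := hψ.comp (contDiff_id.div_const τ)
    have hφ0 : ∀ t, t ∉ Set.Icc (τ / 4) (3 * τ / 4) → (fun t : ℝ => ψ (t / τ)) t = 0 := by
      intro t ht
      apply hψ0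
      intro h
      apply ht
      have h1 := (le_div_iff₀ hτ).1 h.1
      have h2 := (div_le_iff₀ hτ).1 h.2
      exact ⟨by linarith, by linarith⟩
    have hd : ∀ t, deriv (fun t : ℝ => ψ (t / τ)) t = deriv ψ (t / τ) / τ := by
      intro t
      have h1 : HasDerivAt ψ (deriv ψ (t / τ)) (t / τ) :=
        (hψ.differentiable (by simp) _).hasDerivAt
      have h2 := h1.comp t ((hasDerivAt_id t).div_const τ)
      have h3 := h2.deriv
      rw [mul_one_div] at h3
      exact h3
    have hmul := bt_multiplier T B hTcont hder hcomm R hR M hM (τ / 4) (3 * τ / 4) (by positivity)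
      _ hφ hφ0 z
    have hφ' : ContDiff ℝ (⊤ : ℕ∞) (deriv (fun t : ℝ => ψ (t / τ))) :=
      (contDiff_infty_iff_deriv.1 hφ).2
    have hφ0' := bt_deriv_good _ _ _ hφ0
    have icomp : ∀ f : ℝ → ℝ, Continuous f → (∀ t, t ∉ Set.Icc (τ / 4) (3 * τ / 4) → f t = 0) →
        Integrable f := fun f hf h0 => hf.integrable_of_hasCompactSupport
          (HasCompactSupport.intro isCompact_Icc (K := Set.Icc (τ / 4) (3 * τ / 4)) h0)
    have lower : τ * c0 * ‖T τ (B (B (B (B z))))‖ ^ 2 ≤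
        ∫ t, ‖ψ (t / τ) • T t (B (B (B (B z))))‖ ^ 2 := by
      have : τ * c0 * ‖T τ (B (B (B (B z))))‖ ^ 2 =
          ∫ t, ψ (t / τ) ^ 2 * ‖T τ (B (B (B (B z))))‖ ^ 2 := by
        rw [integral_mul_const, Measure.integral_comp_div (fun t => ψ t ^ 2) τ, abs_of_pos hτ,
          smul_eq_mul]
      rw [this]
      refine integral_mono (icomp _ (by have := hφ.continuous; fun_prop) fun t ht => ?_)
        (icomp _ ((bt_W_cont T hTcont _ _ (by positivity) _ hφ hφ0 _).norm.pow 2)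
          fun t ht => ?_) ?_
      · have := hφ0 t ht
        simp only at this
        simp [this]
      · have := hφ0 t ht
        simp only at this
        simp [this]
      · intro t
        by_cases ht : t ∈ Set.Icc (τ / 4) (3 * τ / 4)
        · simp only [norm_smul, mul_pow, Real.norm_eq_abs, sq_abs]
          have ht0 : 0 ≤ t := le_trans (by positivity) ht.1
          have ht1 : 0 ≤ τ - t := by linarith [ht.2]
          have e := hTadd (τ - t) t ht1 ht0
          rw [sub_add_cancel] at e
          rw [e, ContinuousLinearMap.comp_apply]
          have := (T (τ - t)).le_of_opNorm_le (hcontr _ ht1) (T t (B (B (B (B z)))))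
          rw [one_mul] at this
          gcongr
        · have := hφ0 t ht
          simp only at this
          simp [this]
    have upper : ∫ t, ‖deriv (fun t : ℝ => ψ (t / τ)) t • T t (B (B z))‖ ^ 2 ≤
        c1 / τ * ‖B (B z)‖ ^ 2 := by
      have : c1 / τ * ‖B (B z)‖ ^ 2 =
          ∫ t, (deriv (fun t : ℝ => ψ (t / τ)) t) ^ 2 * ‖B (B z)‖ ^ 2 := by
        rw [integral_mul_const]
        simp only [hd, div_pow]
        rw [integral_div, Measure.integral_comp_div (fun t => deriv ψ t ^ 2) τ, abs_of_pos hτ,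
          smul_eq_mul, ← hc1]
        field_simp
      rw [this]
      refine integral_mono (icomp _ ((bt_W_cont T hTcont _ _ (by positivity) _ hφ' hφ0' _).norm.pow 2)
          fun t ht => ?_) (icomp _ (by have := hφ'.continuous; fun_prop) fun t ht => ?_) ?_
      · simp [hφ0' t ht]
      · simp [hφ0' t ht]
      · intro t
        by_cases ht : t ∈ Set.Icc (τ / 4) (3 * τ / 4)
        · simp only [norm_smul, mul_pow, Real.norm_eq_abs, sq_abs]
          have ht0 : 0 ≤ t := le_trans (by positivity) ht.1
          have := (T t).le_of_opNorm_le (hcontr _ ht0) (B (B z))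
          rw [one_mul] at this
          gcongr
        · simp [hφ0' t ht]
    have fin : ‖T τ (B (B (B (B z))))‖ ^ 2 ≤ (Real.sqrt (M ^ 2 * c1 / c0) / τ * ‖B (B z)‖) ^ 2 := by
      rw [mul_pow, div_pow, Real.sq_sqrt (by positivity)]
      have h1 : τ * c0 * ‖T τ (B (B (B (B z))))‖ ^ 2 ≤ M ^ 2 * (c1 / τ * ‖B (B z)‖ ^ 2) :=
        lower.trans (hmul.trans (mul_le_mul_of_nonneg_left upper (sq_nonneg _)))
      rw [← le_div_iff₀' (by positivity)] at h1
      refine h1.trans (le_of_eq ?_)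
      field_simp
    exact (pow_le_pow_iff_left₀ (norm_nonneg _) (by positivity) two_ne_zero).1 fin
  have hdense2 : DenseRange (fun z => B (B z)) := hdense.comp hdense B.continuous
  refine hdense2.induction_on (p := fun x => ‖T τ (B (B x))‖ ≤
    Real.sqrt (M ^ 2 * c1 / c0) / τ * ‖x‖) x ?_ main
  exact isClosed_le (by fun_prop) (by fun_prop)

theorem bt_resolvent_bound (B : H →L[ℂ] H) (R : ℝ → H →L[ℂ] H)
    (hBR : ∀ (lam : ℝ) (y : H), R lam y = B y + (I * (lam : ℂ)) • B (R lam y))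
    (hres : ∀ (lam mu : ℝ) (y : H),
      R mu y = R lam y - (I * ((lam - mu : ℝ) : ℂ)) • R lam (R mu y))
    (hRbound : ∃ C > (0 : ℝ), ∃ Λ > (0 : ℝ), ∀ lam : ℝ, Λ ≤ |lam| →
      ‖R lam‖ ≤ C * lam ^ 2) :
    ∃ M : ℝ, ∀ lam y, ‖B (B (R lam y))‖ ≤ M * ‖y‖ := by
  obtain ⟨C, hC, Λ, hΛ, hb⟩ := hRbound
  have hloc : ∃ K, ∀ lam ∈ Set.Icc (-Λ) Λ, ‖R lam‖ ≤ K := by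
    refine isCompact_Icc.induction_on (p := fun s => ∃ K, ∀ lam ∈ s, ‖R lam‖ ≤ K) ⟨0, by simp⟩
      (fun s t hst ⟨K, hK⟩ => ⟨K, fun l hl => hK l (hst hl)⟩)
      (fun s t ⟨K, hK⟩ ⟨L, hL⟩ => ⟨max K L, fun l hl => hl.elim
        (fun h => (hK l h).trans (le_max_left _ _)) (fun h => (hL l h).trans (le_max_right _ _))⟩) ?_
    intro mu _
    have hev : ∀ᶠ lam in nhds mu, |lam - mu| * ‖R mu‖ < 1 / 2 := by
      have hc : Continuous fun lam : ℝ => |lam - mu| * ‖R mu‖ := by fun_prop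
      exact hc.continuousAt.eventually_lt continuousAt_const (by simp)
    refine ⟨_, mem_nhdsWithin_of_mem_nhds hev, 2 * ‖R mu‖, ?_⟩
    intro lam hlam
    have hlam' : |lam - mu| * ‖R mu‖ < 1 / 2 := hlam
    have h1 : ‖R lam‖ ≤ ‖R mu‖ + |lam - mu| * (‖R lam‖ * ‖R mu‖) := by
      apply ContinuousLinearMap.opNorm_le_bound _ (by positivity)
      intro y
      have e : R lam y = R mu y + (I * ((lam - mu : ℝ) : ℂ)) • R lam (R mu y) := by
        rw [← sub_eq_iff_eq_add]; exact (hres lam mu y).symm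
      rw [e]
      refine (norm_add_le _ _).trans ?_
      rw [norm_smul, norm_mul, Complex.norm_I, one_mul, Complex.norm_real, Real.norm_eq_abs,
        add_mul, mul_assoc, mul_assoc]
      have h2 := (R mu).le_opNorm y
      have h3 := (R lam).le_opNorm_of_le h2
      gcongr
    nlinarith [norm_nonneg (R lam)]
  obtain ⟨K, hK⟩ := hloc
  refine ⟨‖B‖ * ‖B‖ * K + (C + ‖B‖ / Λ ^ 2 + ‖B‖ * ‖B‖ / Λ), ?_⟩
  have hK0 : 0 ≤ K := (norm_nonneg _).trans (hK 0 ⟨by linarith, hΛ.le⟩)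
  intro lam y
  rcases le_or_gt Λ |lam| with h | h
  · have hl0 : 0 < |lam| := hΛ.trans_le h
    have hlam : (lam : ℂ) ≠ 0 := by
      simpa using abs_pos.1 hl0
    have hI : (I * (lam : ℂ)) ≠ 0 := mul_ne_zero I_ne_zero hlam
    have e1 : B (R lam y) = (I * (lam : ℂ))⁻¹ • (R lam y - B y) := by
      have : R lam y - B y = (I * (lam : ℂ)) • B (R lam y) := by
        rw [sub_eq_iff_eq_add']; exact hBR lam y
      rw [this, smul_smul, inv_mul_cancel₀ hI, one_smul]
    have e2 : B (B (R lam y)) = (I * (lam : ℂ))⁻¹ • ((I * (lam : ℂ))⁻¹ • (R lam y - B y) - B (B y)) := by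
      conv_lhs => rw [e1]
      rw [map_smul, map_sub, e1]
    have nI : ‖(I * (lam : ℂ))⁻¹‖ = |lam|⁻¹ := by
      rw [norm_inv, norm_mul, Complex.norm_I, one_mul, Complex.norm_real, Real.norm_eq_abs]
    have hR := (R lam).le_of_opNorm_le (hb lam h) y
    have hB1 := B.le_opNorm y
    have hB2 := B.le_opNorm_of_le hB1
    have h3 : ‖B (B (R lam y))‖ ≤ |lam|⁻¹ * (|lam|⁻¹ * (C * lam ^ 2 * ‖y‖ + ‖B‖ * ‖y‖) +
        ‖B‖ * (‖B‖ * ‖y‖)) := by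
      rw [e2, norm_smul, nI]
      gcongr
      refine (norm_sub_le _ _).trans ?_
      rw [norm_smul, nI]
      gcongr
      exact (norm_sub_le _ _).trans (by gcongr)
    have h4 : |lam|⁻¹ * (|lam|⁻¹ * (C * lam ^ 2 * ‖y‖ + ‖B‖ * ‖y‖) +
        ‖B‖ * (‖B‖ * ‖y‖)) = (C + ‖B‖ / |lam| ^ 2 + ‖B‖ * ‖B‖ / |lam|) * ‖y‖ := by
      rw [← sq_abs lam]; field_simp
    rw [h4] at h3
    refine h3.trans (mul_le_mul_of_nonneg_right ?_ (norm_nonneg _))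
    have : 0 ≤ ‖B‖ * ‖B‖ * K := by positivity
    have h5 : ‖B‖ / |lam| ^ 2 ≤ ‖B‖ / Λ ^ 2 := by gcongr
    have h6 : ‖B‖ * ‖B‖ / |lam| ≤ ‖B‖ * ‖B‖ / Λ := by gcongr
    linarith
  · have h1 := (R lam).le_of_opNorm_le (hK lam (abs_le.1 h.le)) y
    have h2 := B.le_opNorm_of_le (B.le_opNorm_of_le h1)
    refine h2.trans ?_
    have h7 : ‖B‖ * (‖B‖ * (K * ‖y‖)) = ‖B‖ * ‖B‖ * K * ‖y‖ := by ring
    rw [h7]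
    gcongr
    have : 0 ≤ C + ‖B‖ / Λ ^ 2 + ‖B‖ * ‖B‖ / Λ := by positivity
    linarith

end semigroup

/-- **Borichev–Tomilov polynomial decay.** Let `−𝒜` generate a strongly continuous
contraction semigroup `T t = e^{−t𝒜}` on a Hilbert space, with `σ(𝒜) ∩ iℝ = ∅` and `𝒜`
invertible (witnessed by the bounded resolvents `R lam = (𝒜 − iλ)⁻¹` and `Ainv = 𝒜⁻¹`),
and suppose `‖(𝒜 − iλ)⁻¹‖ = O(λ²)` as `λ → ±∞`. Then `‖e^{−t𝒜}𝒜⁻¹‖ = O(t^{-1/2})` as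
`t → ∞`, and `‖e^{−t𝒜}x‖ = o(t^{-1/2})` for every `x ∈ dom(𝒜)`. -/
theorem stmt19
    {𝓗 : Type*} [NormedAddCommGroup 𝓗] [InnerProductSpace ℂ 𝓗] [CompleteSpace 𝓗]
    (Dom : Submodule ℂ 𝓗) (𝒜 : Dom →ₗ[ℂ] 𝓗)
    (T : ℝ → 𝓗 →L[ℂ] 𝓗)
    (hT0 : T 0 = 1)
    (hTadd : ∀ s t : ℝ, 0 ≤ s → 0 ≤ t → T (s + t) = (T s).comp (T t))
    (hcontr : ∀ t : ℝ, 0 ≤ t → ‖T t‖ ≤ 1)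
    (hTcont : ∀ x : 𝓗, ContinuousOn (fun t : ℝ => T t x) (Set.Ici 0))
    (hgen : ∀ (x : Dom) (t : ℝ), 0 ≤ t →
      HasDerivWithinAt (fun s : ℝ => T s (x : 𝓗)) (-(T t (𝒜 x))) (Set.Ici 0) t)
    (Ainv : 𝓗 →L[ℂ] 𝓗)
    (hAmem : ∀ y : 𝓗, Ainv y ∈ Dom)
    (hA1 : ∀ y : 𝓗, 𝒜 ⟨Ainv y, hAmem y⟩ = y)
    (hA2 : ∀ x : Dom, Ainv (𝒜 x) = (x : 𝓗))
    (R : ℝ → 𝓗 →L[ℂ] 𝓗)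
    (hRmem : ∀ (lam : ℝ) (y : 𝓗), R lam y ∈ Dom)
    (hR1 : ∀ (lam : ℝ) (y : 𝓗),
      𝒜 ⟨R lam y, hRmem lam y⟩ - (I * (lam : ℂ)) • R lam y = y)
    (hR2 : ∀ (lam : ℝ) (x : Dom),
      R lam (𝒜 x - (I * (lam : ℂ)) • (x : 𝓗)) = (x : 𝓗))
    (hRbound : ∃ C > (0 : ℝ), ∃ Λ > (0 : ℝ), ∀ lam : ℝ, Λ ≤ |lam| →
      ‖R lam‖ ≤ C * lam ^ 2) :
    (∃ C > (0 : ℝ), ∃ t₀ > (0 : ℝ), ∀ t : ℝ, t₀ ≤ t →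
      ‖(T t).comp Ainv‖ ≤ C / Real.sqrt t)
    ∧ ∀ x : Dom, Tendsto (fun t : ℝ => Real.sqrt t * ‖T t ((x : 𝓗))‖) atTop (nhds 0) := by
  have hder : ∀ (y : 𝓗) (t : ℝ), 0 ≤ t →
      HasDerivWithinAt (fun s : ℝ => T s (Ainv y)) (-(T t y)) (Set.Ici 0) t := by
    intro y t ht
    have := hgen ⟨Ainv y, hAmem y⟩ t ht
    rwa [hA1] at this
  have hcomm : ∀ t, 0 ≤ t → ∀ y, T t (Ainv y) = Ainv (T t y) := fun t ht y =>
    bt_comm T Ainv hT0 hTadd hcontr hder t ht y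
  have hdense := bt_dense T Ainv hT0 hder hcomm
  have hR : ∀ (lam : ℝ) (g : 𝓗), R lam (g - (I * (lam : ℂ)) • Ainv g) = Ainv g := by
    intro lam g
    have := hR2 lam ⟨Ainv g, hAmem g⟩
    rwa [hA1] at this
  have hBR : ∀ (lam : ℝ) (y : 𝓗), R lam y = Ainv y + (I * (lam : ℂ)) • Ainv (R lam y) := by
    intro lam y
    have h1 := congrArg Ainv (hR1 lam y)
    rw [map_sub, hA2, map_smul] at h1
    rw [← h1]; simp
  have hres : ∀ (lam mu : ℝ) (y : 𝓗),
      R mu y = R lam y - (I * ((lam - mu : ℝ) : ℂ)) • R lam (R mu y) := by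
    intro lam mu y
    have h1 := hR2 lam ⟨R mu y, hRmem mu y⟩
    have h2 : 𝒜 ⟨R mu y, hRmem mu y⟩ = y + (I * (mu : ℂ)) • R mu y := by
      rw [← sub_eq_iff_eq_add]; exact hR1 mu y
    rw [h2] at h1
    have h3 : y + (I * (mu : ℂ)) • R mu y - (I * (lam : ℂ)) • R mu y =
        y - (I * ((lam - mu : ℝ) : ℂ)) • R mu y := by
      push_cast
      rw [mul_sub, sub_smul]; abel
    simp only [h3] at h1
    rw [map_sub, map_smul] at h1
    exact h1.symm
  obtain ⟨M, hM⟩ := bt_resolvent_bound Ainv R hBR hres hRbound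
  obtain ⟨K, hK0, hK⟩ := bt_decay2 T Ainv hTadd hcontr hTcont hder hcomm hdense R hR M hM
  have hcv : ∀ t, 0 ≤ t → ∀ x, ‖T t x‖ ≤ ‖x‖ := by
    intro t ht x
    simpa using (T t).le_of_opNorm_le (hcontr t ht) x
  -- Landau inequality
  have landau : ∀ (w : 𝓗) (s : ℝ), 0 < s →
      s * ‖Ainv w‖ ≤ 2 * ‖Ainv (Ainv w)‖ + s * s * ‖w‖ := by
    intro w s hs
    have h1 : ∀ r ∈ Set.Icc 0 s, ‖T r (Ainv w) - Ainv w‖ ≤ s * ‖w‖ := by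
      intro r hr
      have := bt_mvt T Ainv hT0 hder w 0 ‖w‖ r hr.1 (fun q hq => by simpa using hcv q hq.1 w)
      rw [smul_zero, add_zero] at this
      refine this.trans ?_
      rw [mul_comm]
      exact mul_le_mul_of_nonneg_right hr.2 (norm_nonneg _)
    have h2 := bt_mvt T Ainv hT0 hder (Ainv w) (Ainv w) (s * ‖w‖) s hs.le h1
    have h3 : ‖s • Ainv w‖ = s * ‖Ainv w‖ := by
      rw [norm_smul, Real.norm_eq_abs, abs_of_pos hs]
    have h4 : s • Ainv w = (T s (Ainv (Ainv w)) - Ainv (Ainv w) + s • Ainv w)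
        + (Ainv (Ainv w) - T s (Ainv (Ainv w))) := by abel
    rw [← h3, h4]
    have h5 := norm_add_le (T s (Ainv (Ainv w)) - Ainv (Ainv w) + s • Ainv w)
      (Ainv (Ainv w) - T s (Ainv (Ainv w)))
    have h6 := norm_sub_le (Ainv (Ainv w)) (T s (Ainv (Ainv w)))
    have h7 := hcv s hs.le (Ainv (Ainv w))
    linarith
  have hroot : ∀ t : ℝ, 0 < t → ∀ x, Real.sqrt t * ‖T t (Ainv x)‖ ≤ (2 * K + 1) * ‖x‖ := by
    intro t ht x
    have hst : 0 < Real.sqrt t := Real.sqrt_pos.2 ht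
    have hsq : Real.sqrt t * Real.sqrt t = t := Real.mul_self_sqrt ht.le
    have h1 := landau (T t x) (Real.sqrt t)⁻¹ (by positivity)
    rw [← hcomm t ht.le, ← hcomm t ht.le] at h1
    have h2 := hK t ht x
    have h3 := hcv t ht.le x
    have h4 : t * ((Real.sqrt t)⁻¹ * ‖T t (Ainv x)‖) ≤
        t * (2 * (K / t * ‖x‖) + (Real.sqrt t)⁻¹ * (Real.sqrt t)⁻¹ * ‖x‖) := by
      gcongr
      refine h1.trans ?_
      gcongr
    have e1 : t * ((Real.sqrt t)⁻¹ * ‖T t (Ainv x)‖) = Real.sqrt t * ‖T t (Ainv x)‖ := by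
      nth_rewrite 1 [← hsq]
      field_simp
    have e2 : t * (2 * (K / t * ‖x‖) + (Real.sqrt t)⁻¹ * (Real.sqrt t)⁻¹ * ‖x‖) =
        (2 * K + 1) * ‖x‖ := by
      rw [← mul_inv, hsq]
      field_simp
    rwa [e1, e2] at h4
  refine ⟨⟨2 * K + 1, by positivity, 1, one_pos, ?_⟩, ?_⟩
  · intro t ht
    have ht0 : 0 < t := by linarith
    have hst : 0 < Real.sqrt t := Real.sqrt_pos.2 ht0
    apply ContinuousLinearMap.opNorm_le_bound _ (by positivity)
    intro x
    rw [ContinuousLinearMap.comp_apply, div_mul_eq_mul_div, le_div_iff₀' hst]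
    exact hroot t ht0 x
  · intro x
    rw [Metric.tendsto_atTop]
    intro ε hε
    have hx : (x : 𝓗) = Ainv (𝒜 x) := (hA2 x).symm
    obtain ⟨y, hy⟩ := hdense.exists_dist_lt (𝒜 x)
      (show 0 < ε / (2 * (2 * K + 1)) by positivity)
    rw [dist_eq_norm] at hy
    refine ⟨max 1 ((2 * (K * ‖y‖ + 1) / ε) ^ 2), ?_⟩
    intro t ht
    have ht0 : 0 < t := lt_of_lt_of_le one_pos ((le_max_left _ _).trans ht)
    have hst : 0 < Real.sqrt t := Real.sqrt_pos.2 ht0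
    have hbig : 2 * (K * ‖y‖ + 1) / ε ≤ Real.sqrt t :=
      Real.le_sqrt_of_sq_le ((le_max_right _ _).trans ht)
    rw [Real.dist_eq, sub_zero, abs_of_nonneg (by positivity), hx]
    have h1 := hroot t ht0 (𝒜 x - Ainv y)
    have h2 := hK t ht0 y
    have h3 : T t (Ainv (𝒜 x)) = T t (Ainv (𝒜 x - Ainv y)) + T t (Ainv (Ainv y)) := by
      rw [← map_add, ← map_add, sub_add_cancel]
    have h4 : (2 * K + 1) * ‖𝒜 x - Ainv y‖ < ε / 2 := by
      rw [lt_div_iff₀ (by positivity)] at hy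
      linarith
    have h5 : Real.sqrt t * ‖T t (Ainv (Ainv y))‖ < ε / 2 := by
      have h6 : Real.sqrt t * (K / t * ‖y‖) = K * ‖y‖ / Real.sqrt t := by
        nth_rewrite 2 [← Real.mul_self_sqrt ht0.le]
        field_simp
      refine lt_of_le_of_lt (mul_le_mul_of_nonneg_left h2 hst.le) ?_
      rw [h6, div_lt_iff₀ hst]
      rw [div_le_iff₀ hε] at hbig
      linarith
    calc Real.sqrt t * ‖T t (Ainv (𝒜 x))‖
        ≤ Real.sqrt t * (‖T t (Ainv (𝒜 x - Ainv y))‖ + ‖T t (Ainv (Ainv y))‖) := by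
          rw [h3]; gcongr; exact norm_add_le _ _
      _ < ε := by rw [mul_add]; linarith
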